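/- Let 0 < q < 1, σ ∈ S_k fixed, and π ∼ Maj(n,q). Let T_σ(π) count occurrences of σ in π. Then Var(T_σ(π)) = O(n^{2k-1}) as n → ∞; equivalently, there is a constant C (depending on q, σ) such that Var(T_σ(π)) ≤ C n^{2k-1} for all n ≥ k. -/

import Mathlib

/-- The major index of a word `w` of length `N`. -/
def wmaj {N : ℕ} {α : Type*} [LinearOrder α] (w : Fin N → α) : ℕ :=
  ∑ i ∈ Finset.range (N - 1),
    if h : i + 1 < N then
      (if w ⟨i + 1, h⟩ < w ⟨i, Nat.lt_of_succ_lt h⟩ then i + 1 else 0)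
    else 0

/-- The major index of a permutation. -/
def maj {n : ℕ} (π : Equiv.Perm (Fin n)) : ℕ := wmaj (fun i => π i)

/-- The `q`-integer `[m]_q = 1 + q + ⋯ + q^{m-1}`. -/
def qint (q : ℝ) (m : ℕ) : ℝ := ∑ j ∈ Finset.range m, q ^ j

/-- The `q`-factorial `[n]_q! = ∏_{i=1}^n [i]_q`. -/
def qfact (q : ℝ) (n : ℕ) : ℝ := ∏ i ∈ Finset.range n, qint q (i + 1)

/-- `patternCount σ π` is the number of occurrences of the pattern `σ ∈ S_k` in `π ∈ Sₙ`. -/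
def patternCount {k n : ℕ} (σ : Equiv.Perm (Fin k)) (π : Equiv.Perm (Fin n)) : ℕ :=
  (Finset.univ.filter (fun f : Fin k → Fin n =>
    StrictMono f ∧ ∀ a b : Fin k, σ a < σ b ↔ π (f a) < π (f b))).card

/-- Expectation of a real-valued statistic under `Maj(n,q)`. -/
noncomputable def majExp (q : ℝ) (n : ℕ) (X : Equiv.Perm (Fin n) → ℝ) : ℝ :=
  ∑ π : Equiv.Perm (Fin n), X π * (q ^ maj π / qfact q n)

open MeasureTheory ProbabilityTheory

section helpers

/-- The sorting key of a letter: larger letters first, ties by increasing position. -/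
def wkey {n : ℕ} (w : Fin n → ℕ) (v : Fin n) : ℕᵒᵈ ×ₗ Fin n :=
  toLex (OrderDual.toDual (w v), v)

lemma wkey_lt {n : ℕ} (w : Fin n → ℕ) (u v : Fin n) :
    wkey w u < wkey w v ↔ w v < w u ∨ (w u = w v ∧ u < v) := by
  unfold wkey
  rw [Prod.Lex.toLex_lt_toLex]
  simp

lemma wkey_inj {n : ℕ} (w : Fin n → ℕ) : Function.Injective (wkey w) := by
  intro u v h
  have := congrArg (fun x => (ofLex x).2) h
  simpa [wkey] using this

/-- The permutation sorting the word. -/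
def wsort {n : ℕ} (w : Fin n → ℕ) : Equiv.Perm (Fin n) := Tuple.sort (wkey w)

lemma wsort_strictMono {n : ℕ} (w : Fin n → ℕ) : StrictMono (wkey w ∘ wsort w) :=
  (Tuple.monotone_sort (wkey w)).strictMono_of_injective
    ((wkey_inj w).comp (wsort w).injective)

lemma wsort_eq_iff {n : ℕ} (w : Fin n → ℕ) (π : Equiv.Perm (Fin n)) :
    wsort w = π ↔ StrictMono (wkey w ∘ π) := by
  constructor
  · rintro rfl; exact wsort_strictMono w
  · intro h
    have := Tuple.unique_monotone (wsort_strictMono w).monotone h.monotone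
    ext i
    have h2 := congrFun this i
    exact congrArg Fin.val (wkey_inj w h2)

/-- number of descents of `π` at or after `j` -/
def dshift {n : ℕ} (π : Equiv.Perm (Fin n)) (j : Fin n) : ℕ :=
  ∑ i ∈ Finset.range (n - 1),
    if h : i + 1 < n then
      (if π ⟨i + 1, h⟩ < π ⟨i, Nat.lt_of_succ_lt h⟩ then (if (j : ℕ) ≤ i then 1 else 0) else 0)
    else 0

lemma sum_dshift {n : ℕ} (π : Equiv.Perm (Fin n)) : ∑ j, dshift π j = maj π := by
  unfold dshift maj wmaj
  rw [Finset.sum_comm]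
  refine Finset.sum_congr rfl fun i hi => ?_
  split_ifs with h h2
  · rw [Finset.sum_boole]
    have : (Finset.univ.filter fun x : Fin n => (x : ℕ) ≤ i) = Finset.Iic ⟨i, by omega⟩ := by
      ext x; simp [Fin.le_def]
    rw [this]; simp
  · simp
  · simp

lemma dshift_succ {m : ℕ} (π : Equiv.Perm (Fin (m + 1))) (i : Fin m) :
    dshift π i.castSucc = dshift π i.succ + if π i.succ < π i.castSucc then 1 else 0 := by
  unfold dshift
  have : (if π i.succ < π i.castSucc then 1 else 0) = ∑ j ∈ Finset.range (m + 1 - 1),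
      if j = (i : ℕ) then (if π i.succ < π i.castSucc then 1 else 0) else 0 := by
    rw [Finset.sum_ite_eq']; simp
  rw [this, ← Finset.sum_add_distrib]
  refine Finset.sum_congr rfl fun j hj => ?_
  have hj' : j + 1 < m + 1 := by simpa using hj
  simp only [hj', dif_pos, Fin.val_castSucc, Fin.val_succ]
  by_cases hji : j = i
  · subst hji
    have e1 : (⟨(i : ℕ) + 1, hj'⟩ : Fin (m + 1)) = i.succ := rfl
    have e2 : (⟨(i : ℕ), Nat.lt_of_succ_lt hj'⟩ : Fin (m + 1)) = i.castSucc := rfl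
    simp [e1, e2]
  · have : (i : ℕ) ≤ j ↔ (i : ℕ) + 1 ≤ j := by omega
    simp [hji, this]

lemma dshift_last {m : ℕ} (π : Equiv.Perm (Fin (m + 1))) : dshift π (Fin.last m) = 0 := by
  unfold dshift
  refine Finset.sum_eq_zero fun j hj => ?_
  have : ¬ (m ≤ j) := by simpa using hj
  simp [this]

lemma strictMono_iff_shift {n : ℕ} (π : Equiv.Perm (Fin n)) (x : Fin n → ℕ) :
    StrictMono (wkey (x ∘ π.symm) ∘ π) ↔ ∃ y, Antitone y ∧ y + dshift π = x := by
  cases n with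
  | zero =>
    constructor
    · intro _; exact ⟨x, fun i => i.elim0, funext fun i => i.elim0⟩
    · intro _ i; exact i.elim0
  | succ m =>
    rw [Fin.strictMono_iff_lt_succ]
    have key : ∀ i : Fin m, ((wkey (x ∘ π.symm) ∘ π) i.castSucc < (wkey (x ∘ π.symm) ∘ π) i.succ ↔
        x i.succ + (if π i.succ < π i.castSucc then 1 else 0) ≤ x i.castSucc) := by
      intro i
      simp only [Function.comp_apply, wkey_lt, Equiv.symm_apply_apply]
      have hne : π i.succ ≠ π i.castSucc := fun h => by
        have := π.injective h
        simp [Fin.ext_iff] at this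
      split_ifs with h
      · have := h.not_gt; simp [this]
      · have h3 : π i.castSucc < π i.succ := lt_of_le_of_ne (not_lt.1 h) hne.symm
        simp [h3]; omega
    simp only [key]
    constructor
    · intro h
      have hle : ∀ j, dshift π j ≤ x j := by
        intro j
        induction j using Fin.reverseInduction with
        | last => rw [dshift_last]; exact Nat.zero_le _
        | cast i ih => have := h i; rw [dshift_succ]; omega
      refine ⟨fun j => x j - dshift π j, ?_, ?_⟩
      · rw [Fin.antitone_iff_succ_le]
        intro i
        have := h i
        have h1 := hle i.succ
        simp only [dshift_succ]
        omega
      · funext j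
        have := hle j
        simp only [Pi.add_apply]; omega
    · rintro ⟨y, hy, rfl⟩ i
      have := hy (Fin.castSucc_le_succ i)
      simp only [Pi.add_apply, dshift_succ]
      omega

variable {q : ℝ}

/-- Weight of a word. -/
noncomputable def wwt (q : ℝ) {n : ℕ} (x : Fin n → ℕ) : ENNReal :=
  ∏ i, ENNReal.ofReal (q ^ x i * (1 - q))

lemma wwt_add (hq0 : 0 < q) {n : ℕ} (y e : Fin n → ℕ) :
    wwt q (y + e) = ENNReal.ofReal (q ^ ∑ i, e i) * wwt q y := by
  unfold wwt
  rw [← Finset.prod_pow_eq_pow_sum, ENNReal.ofReal_prod_of_nonneg (fun i _ => by positivity),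
    ← Finset.prod_mul_distrib]
  refine Finset.prod_congr rfl fun i _ => ?_
  rw [← ENNReal.ofReal_mul (by positivity), Pi.add_apply, pow_add]
  congr 1; ring

open Classical in
/-- Total weight of antitone words. -/
noncomputable def awt (q : ℝ) (n : ℕ) : ENNReal :=
  ∑' x : Fin n → ℕ, if Antitone x then wwt q x else 0

open Classical in
lemma tsum_sort (hq0 : 0 < q) {n : ℕ} (π : Equiv.Perm (Fin n)) :
    (∑' w : Fin n → ℕ, if wsort w = π then wwt q w else 0)
      = ENNReal.ofReal (q ^ maj π) * awt q n := by
  have h1 : (∑' w : Fin n → ℕ, if wsort w = π then wwt q w else 0)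
      = ∑' x : Fin n → ℕ, if (∃ y, Antitone y ∧ y + dshift π = x) then wwt q x else 0 := by
    rw [← (Equiv.arrowCongr π (Equiv.refl ℕ)).tsum_eq]
    refine tsum_congr fun x => ?_
    have e : (Equiv.arrowCongr π (Equiv.refl ℕ)) x = x ∘ π.symm := by ext; simp
    rw [e]
    have e2 : wwt q (x ∘ π.symm) = wwt q x := by
      unfold wwt
      exact Equiv.prod_comp π.symm (fun i => ENNReal.ofReal (q ^ x i * (1 - q)))
    simp only [wsort_eq_iff, strictMono_iff_shift, e2]
  rw [h1, awt, ← ENNReal.tsum_mul_left]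
  rw [← (add_left_injective (dshift π)).tsum_eq]
  · refine tsum_congr fun y => ?_
    have : (∃ y', Antitone y' ∧ y' + dshift π = y + dshift π) ↔ Antitone y := by
      constructor
      · rintro ⟨y', h, h'⟩
        rwa [← add_right_cancel h']
      · intro h; exact ⟨y, h, rfl⟩
    simp only [this, wwt_add hq0, sum_dshift]
    split_ifs <;> simp
  · intro x hx
    simp only [Function.mem_support, ne_eq, ite_eq_right_iff, not_forall] at hx
    obtain ⟨⟨y, _, h⟩, _⟩ := hx
    exact ⟨y, h⟩

open Classical in
lemma awt_succ (hq0 : 0 < q) (n : ℕ) :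
    awt q (n + 1) = ENNReal.ofReal (1 - q) * awt q n
      + ENNReal.ofReal (q ^ (n + 1)) * awt q (n + 1) := by
  have h0 : awt q (n + 1) = (∑' x : Fin (n + 1) → ℕ,
        if Antitone x ∧ x (Fin.last n) = 0 then wwt q x else 0)
      + ∑' x : Fin (n + 1) → ℕ, if Antitone x ∧ x (Fin.last n) ≠ 0 then wwt q x else 0 := by
    rw [← ENNReal.tsum_add]
    refine tsum_congr fun x => ?_
    by_cases h1 : Antitone x <;> by_cases h2 : x (Fin.last n) = 0 <;> simp [h1, h2]
  have hA : (∑' x : Fin (n + 1) → ℕ,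
        if Antitone x ∧ x (Fin.last n) = 0 then wwt q x else 0)
      = ENNReal.ofReal (1 - q) * awt q n := by
    have hinj : Function.Injective
        (fun y : Fin n → ℕ => (Fin.snoc y 0 : Fin (n + 1) → ℕ)) := by
      intro y z h
      have := congrArg (Fin.init (α := fun _ => ℕ)) h
      simpa using this
    rw [← hinj.tsum_eq, awt, ← ENNReal.tsum_mul_left]
    · refine tsum_congr fun y => ?_
      have : Antitone (Fin.snoc y 0 : Fin (n + 1) → ℕ) ↔ Antitone y := by
        constructor
        · intro h i j hij
          have := h (Fin.castSucc_le_castSucc_iff.2 hij)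
          simpa using this
        · intro h i j hij
          induction j using Fin.lastCases with
          | last => simp
          | cast j =>
            induction i using Fin.lastCases with
            | last => exact absurd hij (not_le.2 (Fin.castSucc_lt_last j))
            | cast i => simpa using h (Fin.castSucc_le_castSucc_iff.1 hij)
      have e : wwt q (Fin.snoc y 0 : Fin (n + 1) → ℕ) = ENNReal.ofReal (1 - q) * wwt q y := by
        unfold wwt
        rw [Fin.prod_univ_castSucc, mul_comm]
        simp
      simp only [this, Fin.snoc_last, and_true, e]
      split_ifs <;> simp
    · intro x hx
      simp only [Function.mem_support, ne_eq, ite_eq_right_iff, not_forall] at hx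
      obtain ⟨⟨_, h⟩, _⟩ := hx
      refine ⟨Fin.init x, ?_⟩
      have := Fin.snoc_init_self x
      rw [h] at this
      exact this
  have hB : (∑' x : Fin (n + 1) → ℕ,
        if Antitone x ∧ x (Fin.last n) ≠ 0 then wwt q x else 0)
      = ENNReal.ofReal (q ^ (n + 1)) * awt q (n + 1) := by
    rw [← (add_left_injective (fun _ : Fin (n + 1) => 1)).tsum_eq, awt, ← ENNReal.tsum_mul_left]
    · refine tsum_congr fun y => ?_
      have : Antitone (y + fun _ => 1) ↔ Antitone y := by
        constructor
        · intro h i j hij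
          have := h hij
          simpa using this
        · intro h i j hij
          simpa using h hij
      simp only [this, wwt_add hq0]
      simp
    · intro x hx
      simp only [Function.mem_support, ite_eq_right_iff, not_forall, ne_eq] at hx
      obtain ⟨⟨h1, h⟩, _⟩ := hx
      refine ⟨fun i => x i - 1, ?_⟩
      funext i
      have := h1 (Fin.le_last i)
      simp only [Pi.add_apply]
      omega
  rw [hA, hB] at h0
  exact h0

lemma awt_zero : awt q 0 = 1 := by
  unfold awt wwt
  rw [tsum_eq_single default]
  · have : Antitone (default : Fin 0 → ℕ) := fun i => i.elim0
    rw [if_pos this]; simp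
  · intro b hb; exact absurd (Subsingleton.elim _ _) hb

lemma qfact_pos (hq0 : 0 < q) (n : ℕ) : 0 < qfact q n := by
  unfold qfact qint
  refine Finset.prod_pos fun i _ => ?_
  exact Finset.sum_pos (fun j _ => by positivity) ⟨0, by simp⟩

lemma awt_toReal (hq0 : 0 < q) (hq1 : q < 1) (hfin : ∀ n, awt q n ≠ ⊤) (n : ℕ) :
    (awt q n).toReal = 1 / qfact q n := by
  induction n with
  | zero => simp [awt_zero, qfact]
  | succ n ih =>
    have h := congrArg ENNReal.toReal (awt_succ hq0 n)
    rw [ENNReal.toReal_add (ENNReal.mul_ne_top (by simp) (hfin _))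
      (ENNReal.mul_ne_top (by simp) (hfin _)), ENNReal.toReal_mul, ENNReal.toReal_mul,
      ENNReal.toReal_ofReal (by linarith), ENNReal.toReal_ofReal (by positivity), ih] at h
    have hp := qfact_pos hq0 n
    have hp1 := qfact_pos hq0 (n + 1)
    have e : qfact q (n + 1) = qfact q n * qint q (n + 1) := by
      unfold qfact; rw [Finset.prod_range_succ]
    have e2 : (1 - q) * qint q (n + 1) = 1 - q ^ (n + 1) := by
      unfold qint
      have := mul_neg_geom_sum q (n + 1)
      linarith
    have hlt : q ^ (n + 1) < 1 := pow_lt_one₀ hq0.le hq1 (by simp)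
    rw [eq_div_iff hp1.ne', e]
    have h3 : (awt q (n + 1)).toReal * (1 - q ^ (n + 1)) * qfact q n = (1 - q) := by
      have : (awt q (n + 1)).toReal * (1 - q ^ (n + 1)) = (1 - q) * (1 / qfact q n) := by
        linarith
      rw [this]; field_simp
    have h4 : (1 - q) ≠ 0 := by linarith
    apply mul_left_cancel₀ h4
    rw [mul_one]
    calc _ = (awt q (n + 1)).toReal * ((1 - q) * qint q (n + 1)) * qfact q n := by ring
      _ = _ := by rw [e2, h3]

open Classical in
lemma pi_real_sort (hq0 : 0 < q) (hq1 : q < 1) (μ : Measure ℕ) [IsProbabilityMeasure μ]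
    (hμ : ∀ m, μ {m} = ENNReal.ofReal (q ^ m * (1 - q))) {n : ℕ} (π : Equiv.Perm (Fin n)) :
    (Measure.pi (fun _ : Fin n => μ)).real {w | wsort w = π} = q ^ maj π / qfact q n := by
  have hs : ∀ (m : ℕ) (S : Set (Fin m → ℕ)), (Measure.pi (fun _ : Fin m => μ)) S
      = ∑' w, if w ∈ S then wwt q w else 0 := by
    intro m S
    rw [← Measure.tsum_indicator_apply_singleton _ S (MeasurableSet.of_discrete)]
    refine tsum_congr fun w => ?_
    simp only [Set.indicator_apply, Measure.pi_singleton, hμ, wwt]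
  have hfin : ∀ m, awt q m ≠ ⊤ := by
    intro m
    have : awt q m = (Measure.pi (fun _ : Fin m => μ)) {x | Antitone x} := by
      rw [hs, awt]
      refine tsum_congr fun x => ?_
      by_cases h : Antitone x <;> simp [h]
    rw [this]
    exact measure_ne_top _ _
  have h2 : (Measure.pi (fun _ : Fin n => μ)) {w | wsort w = π}
      = ENNReal.ofReal (q ^ maj π) * awt q n := by
    rw [hs, ← tsum_sort hq0]
    refine tsum_congr fun w => ?_
    by_cases h : wsort w = π <;> simp [h]
  rw [measureReal_def, h2, ENNReal.toReal_mul, ENNReal.toReal_ofReal (by positivity),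
    awt_toReal hq0 hq1 hfin]
  ring

lemma majExp_eq (hq0 : 0 < q) (hq1 : q < 1) (μ : Measure ℕ) [IsProbabilityMeasure μ]
    (hμ : ∀ m, μ {m} = ENNReal.ofReal (q ^ m * (1 - q))) {n : ℕ}
    (X : Equiv.Perm (Fin n) → ℝ) :
    majExp q n X = ∫ w, X (wsort w) ∂(Measure.pi (fun _ : Fin n => μ)) := by
  letI : MeasurableSpace (Equiv.Perm (Fin n)) := ⊤
  haveI : DiscreteMeasurableSpace (Equiv.Perm (Fin n)) := ⟨fun _ => trivial⟩
  have hm : Measurable (wsort (n := n)) := Measurable.of_discrete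
  haveI := Measure.isProbabilityMeasure_map (μ := Measure.pi (fun _ : Fin n => μ)) hm.aemeasurable
  rw [← integral_map (f := X) hm.aemeasurable (by
    exact Measurable.of_discrete.aestronglyMeasurable)]
  rw [integral_fintype (Integrable.of_finite)]
  unfold majExp
  refine Finset.sum_congr rfl fun π _ => ?_
  rw [map_measureReal_apply hm MeasurableSet.of_discrete, smul_eq_mul, mul_comm,
    ← pi_real_sort hq0 hq1 μ hμ π]
  rfl

lemma patternCount_eq {k n : ℕ} (σ : Equiv.Perm (Fin k)) (w : Fin n → ℕ) :
    patternCount σ (wsort w) = (Finset.univ.filter (fun g : Fin k → Fin n =>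
      StrictMono g ∧ StrictMono (wkey w ∘ g ∘ σ))).card := by
  unfold patternCount
  have hs := wsort_strictMono w
  refine Finset.card_bij' (fun f _ => wsort w ∘ f ∘ σ.symm)
    (fun g _ => (wsort w).symm ∘ g ∘ σ) ?_ ?_ ?_ ?_
  · intro f hf
    simp only [Finset.mem_filter, Finset.mem_univ, true_and] at hf ⊢
    refine ⟨fun a b hab => ?_, fun a b hab => ?_⟩
    · exact (hf.2 _ _).1 (by simpa using hab)
    · simpa using hs (hf.1 hab)
  · intro g hg
    simp only [Finset.mem_filter, Finset.mem_univ, true_and] at hg ⊢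
    refine ⟨fun a b hab => ?_, fun a b => ?_⟩
    · rw [← hs.lt_iff_lt]
      simpa using hg.2 hab
    · simp [hg.1.lt_iff_lt]
  · intro f _; funext a; simp
  · intro g _; funext a; simp

lemma indep_event (μ : Measure ℕ) [IsProbabilityMeasure μ] {k n : ℕ} (σ : Equiv.Perm (Fin k))
    (g h : Fin k → Fin n) (hd : ∀ a b, g a ≠ h b) :
    (Measure.pi (fun _ : Fin n => μ)).real
      ({w | StrictMono (wkey w ∘ g ∘ σ)} ∩ {w | StrictMono (wkey w ∘ h ∘ σ)})
    = (Measure.pi (fun _ : Fin n => μ)).real {w | StrictMono (wkey w ∘ g ∘ σ)} *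
      (Measure.pi (fun _ : Fin n => μ)).real {w | StrictMono (wkey w ∘ h ∘ σ)} := by
  have hi : iIndepFun (fun (i : Fin n) (w : Fin n → ℕ) => w i)
      (Measure.pi (fun _ : Fin n => μ)) :=
    iIndepFun_pi (X := fun _ => id) (fun _ => aemeasurable_id)
  have hdisj : Disjoint (Finset.univ.image g) (Finset.univ.image h) := by
    rw [Finset.disjoint_left]
    intro x hx hx'
    simp only [Finset.mem_image, Finset.mem_univ, true_and] at hx hx'
    obtain ⟨a, rfl⟩ := hx
    obtain ⟨b, hb⟩ := hx'
    exact hd a b hb.symm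
  have hI := hi.indepFun_finset _ _ hdisj (fun i => measurable_pi_apply i)
  have := hI.measure_inter_preimage_eq_mul
    {v | StrictMono (fun a : Fin k => (toLex (OrderDual.toDual (v ⟨g (σ a), by simp⟩), g (σ a)) :
      ℕᵒᵈ ×ₗ Fin n))}
    {v | StrictMono (fun a : Fin k => (toLex (OrderDual.toDual (v ⟨h (σ a), by simp⟩), h (σ a)) :
      ℕᵒᵈ ×ₗ Fin n))} MeasurableSet.of_discrete MeasurableSet.of_discrete
  have h2 := congrArg ENNReal.toReal this
  rw [ENNReal.toReal_mul] at h2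
  exact h2

lemma card_pairs {k n : ℕ} (a b : Fin k) :
    (Finset.univ.filter (fun p : (Fin k → Fin n) × (Fin k → Fin n) => p.1 a = p.2 b)).card
      ≤ n ^ (2 * k - 1) := by
  have hk : 0 < k := a.pos
  calc _ ≤ (Finset.univ : Finset ((Fin k → Fin n) × ({j : Fin k // j ≠ b} → Fin n))).card := by
        refine Finset.card_le_card_of_injOn (fun p => (p.1, fun j => p.2 j)) (by simp) ?_
        rintro ⟨g, h⟩ hp ⟨g', h'⟩ hp' heq
        simp only [Finset.coe_filter, Finset.mem_univ, true_and, Set.mem_ofPred_eq] at hp hp'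
        simp only [Prod.mk.injEq] at heq
        obtain ⟨rfl, he⟩ := heq
        refine Prod.ext rfl (funext fun j => ?_)
        by_cases hj : j = b
        · subst hj; exact hp.symm.trans hp'
        · exact congrFun he ⟨j, hj⟩
    _ = n ^ (2 * k - 1) := by
        rw [Finset.card_univ, Fintype.card_prod, Fintype.card_fun, Fintype.card_fun]
        simp only [Fintype.card_fin, Fintype.card_subtype_compl, Fintype.card_subtype_eq, ne_eq]
        rw [← pow_add]; congr 1; omega

open Classical in
lemma variance_aux (hq0 : 0 < q) (hq1 : q < 1) (μ : Measure ℕ) [IsProbabilityMeasure μ]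
    (hμ : ∀ m, μ {m} = ENNReal.ofReal (q ^ m * (1 - q))) {k n : ℕ} (σ : Equiv.Perm (Fin k)) :
    majExp q n (fun π => ((patternCount σ π : ℝ)) ^ 2)
          - (majExp q n (fun π => (patternCount σ π : ℝ))) ^ 2
        ≤ (k : ℝ) ^ 2 * (n : ℝ) ^ (2 * k - 1) := by
  rw [majExp_eq hq0 hq1 μ hμ, majExp_eq hq0 hq1 μ hμ]
  set P := Measure.pi (fun _ : Fin n => μ) with hP
  set G := Finset.univ.filter (fun g : Fin k → Fin n => StrictMono g) with hG
  let E : (Fin k → Fin n) → Set (Fin n → ℕ) := fun g => {w | StrictMono (wkey w ∘ g ∘ σ)}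
  have hT : ∀ w : Fin n → ℕ, (patternCount σ (wsort w) : ℝ)
      = ∑ g ∈ G, (E g).indicator (fun _ => (1 : ℝ)) w := by
    intro w
    rw [patternCount_eq, ← Finset.filter_filter, Finset.card_filter]
    push_cast
    refine Finset.sum_congr rfl fun g _ => ?_
    simp only [Set.indicator_apply, E, Set.mem_ofPred_eq]
  have hint : ∀ S : Set (Fin n → ℕ), Integrable (S.indicator (fun _ => (1 : ℝ))) P := fun S =>
    (integrable_const (1 : ℝ)).indicator MeasurableSet.of_discrete
  have hval : ∀ S : Set (Fin n → ℕ), ∫ w, S.indicator (fun _ => (1 : ℝ)) w ∂P = P.real S :=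
    fun S => by
      rw [integral_indicator_const _ MeasurableSet.of_discrete]; simp
  have h1 : ∫ w, (patternCount σ (wsort w) : ℝ) ∂P = ∑ g ∈ G, P.real (E g) := by
    simp only [hT]
    rw [integral_finsetSum _ (fun g _ => hint _)]
    simp only [hval]
  have h2 : ∫ w, (patternCount σ (wsort w) : ℝ) ^ 2 ∂P
      = ∑ g ∈ G, ∑ h ∈ G, P.real (E g ∩ E h) := by
    have : ∀ w : Fin n → ℕ, (patternCount σ (wsort w) : ℝ) ^ 2
      = ∑ g ∈ G, ∑ h ∈ G, (E g ∩ E h).indicator (fun _ => (1 : ℝ)) w := by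
      intro w
      rw [hT, sq, Finset.sum_mul_sum]
      refine Finset.sum_congr rfl fun g _ => Finset.sum_congr rfl fun h _ => ?_
      simp only [Set.indicator_apply, Set.mem_inter_iff]
      by_cases a : w ∈ E g <;> by_cases b : w ∈ E h <;> simp [a, b]
    simp only [this]
    rw [integral_finsetSum _ (fun g _ => integrable_finsetSum _ (fun h _ => hint _))]
    refine Finset.sum_congr rfl fun g _ => ?_
    rw [integral_finsetSum _ (fun g _ => hint _)]
    simp only [hval]
  rw [h1, h2, sq, Finset.sum_mul_sum, ← Finset.sum_sub_distrib]
  simp only [← Finset.sum_sub_distrib]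
  have hterm : ∀ g h : Fin k → Fin n, P.real (E g ∩ E h) - P.real (E g) * P.real (E h)
      ≤ ∑ a : Fin k, ∑ b : Fin k, if g a = h b then (1 : ℝ) else 0 := by
    intro g h
    by_cases hd : ∀ a b, g a ≠ h b
    · have := indep_event μ σ g h hd
      rw [show P.real (E g ∩ E h) = P.real (E g) * P.real (E h) from this, sub_self]
      exact Finset.sum_nonneg fun a _ => Finset.sum_nonneg fun b _ => by split_ifs <;> norm_num
    · push Not at hd
      obtain ⟨a, b, hab⟩ := hd
      have l1 : P.real (E g ∩ E h) ≤ 1 := measureReal_le_one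
      have l2 : 0 ≤ P.real (E g) * P.real (E h) := by positivity
      have l3 : (1 : ℝ) ≤ ∑ a : Fin k, ∑ b : Fin k, if g a = h b then (1 : ℝ) else 0 := by
        calc (1 : ℝ) = if g a = h b then (1 : ℝ) else 0 := by simp [hab]
          _ ≤ ∑ b : Fin k, if g a = h b then (1 : ℝ) else 0 :=
            Finset.single_le_sum (f := fun b => if g a = h b then (1 : ℝ) else 0)
              (fun b _ => by split_ifs <;> norm_num) (Finset.mem_univ b)
          _ ≤ _ := Finset.single_le_sum
              (f := fun a => ∑ b : Fin k, if g a = h b then (1 : ℝ) else 0)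
              (fun a _ => Finset.sum_nonneg fun b _ => by split_ifs <;> norm_num)
              (Finset.mem_univ a)
      linarith
  have hnn : ∀ g h : Fin k → Fin n,
      (0 : ℝ) ≤ ∑ a : Fin k, ∑ b : Fin k, if g a = h b then (1 : ℝ) else 0 := fun g h =>
    Finset.sum_nonneg fun a _ => Finset.sum_nonneg fun b _ => by split_ifs <;> norm_num
  calc _ ≤ ∑ g ∈ G, ∑ h ∈ G, ∑ a : Fin k, ∑ b : Fin k, (if g a = h b then (1 : ℝ) else 0) :=
        Finset.sum_le_sum fun g _ => Finset.sum_le_sum fun h _ => hterm g h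
    _ = ∑ p ∈ G ×ˢ G, ∑ a : Fin k, ∑ b : Fin k, (if p.1 a = p.2 b then (1 : ℝ) else 0) := by
        rw [Finset.sum_product]
    _ ≤ ∑ p : (Fin k → Fin n) × (Fin k → Fin n), ∑ a : Fin k, ∑ b : Fin k,
          (if p.1 a = p.2 b then (1 : ℝ) else 0) :=
        Finset.sum_le_sum_of_subset_of_nonneg (Finset.subset_univ _) fun p _ _ => hnn p.1 p.2
    _ = ∑ a : Fin k, ∑ b : Fin k, ∑ p : (Fin k → Fin n) × (Fin k → Fin n),
          (if p.1 a = p.2 b then (1 : ℝ) else 0) := by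
        rw [Finset.sum_comm]
        refine Finset.sum_congr rfl fun a _ => ?_
        rw [Finset.sum_comm]
    _ ≤ ∑ a : Fin k, ∑ b : Fin k, (n : ℝ) ^ (2 * k - 1) := by
        refine Finset.sum_le_sum fun a _ => Finset.sum_le_sum fun b _ => ?_
        rw [Finset.sum_boole]
        have := card_pairs (n := n) a b
        exact_mod_cast this
    _ = _ := by simp; ring

end helpers

/-- Under `Maj(n,q)`, the variance of the number of occurrences of a fixed pattern
`σ ∈ S_k` is `O(n^{2k-1})`: there is a constant `C` (depending on `q` and `σ`)
with `Var(T_σ) ≤ C · n^{2k-1}` for all `n ≥ k`. -/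
theorem pattern_count_variance_bound (q : ℝ) (hq0 : 0 < q) (hq1 : q < 1)
    (k : ℕ) (σ : Equiv.Perm (Fin k)) :
    ∃ C : ℝ, ∀ n : ℕ, k ≤ n →
      majExp q n (fun π => ((patternCount σ π : ℝ)) ^ 2)
          - (majExp q n (fun π => (patternCount σ π : ℝ))) ^ 2
        ≤ C * (n : ℝ) ^ (2 * k - 1) := by
  have hp : (1 - q) ∈ Set.Icc (0 : ℝ) 1 := ⟨by linarith, by linarith⟩
  have hp0 : (⟨1 - q, hp⟩ : unitInterval) ≠ 0 := by
    intro h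
    have := congrArg Subtype.val h
    simp at this
    linarith
  refine ⟨(k : ℝ) ^ 2, fun n _ => ?_⟩
  refine variance_aux hq0 hq1 (geometricMeasure ⟨1 - q, hp⟩) (fun m => ?_) σ
  rw [geometricMeasure_singleton hp0]
  simp
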